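/- arXiv:1704.08790 — 2 statements merged into one kernel-verified Lean document; each statement's English description precedes it below -/
import Mathlib

section
/- Let ≺ be a linear order on ℕ whose ≺-least element is 0, let α be an ordinal, and let β : ℕ → Ordinal be a function with β m < α for every m. Assume that for every m, if the set {k ∈ ℕ : k < m in the usual order of ℕ and m ≺ k} is nonempty and s is its ≺-least element, then β m < β s. Then there exists a function f : ℕ → Ordinal such that f m < ω ^ α for every m and such that n ≺ m implies f n < f m; in particular, ≺ embeds into the ordinals below ω ^ α. -/
open Ordinal

open Classical in
noncomputable def takF (prec : ℕ → ℕ → Prop) (β : ℕ → Ordinal) (m : ℕ) : Ordinal :=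
  (Finset.univ : Finset (Fin m)).sup
    (fun i => if prec i.1 m then takF prec β i.1 + ω ^ β m else 0)
termination_by m
decreasing_by exact i.2

theorem takF_ge (prec : ℕ → ℕ → Prop) (β : ℕ → Ordinal) (i m : ℕ) (h : i < m) (hp : prec i m) :
    takF prec β i + ω ^ β m ≤ takF prec β m := by
  classical
  rw [takF.eq_1 prec β m]
  refine le_trans ?_ (Finset.le_sup (Finset.mem_univ (⟨i, h⟩ : Fin m)))
  simp [hp]

theorem takF_le (prec : ℕ → ℕ → Prop) (β : ℕ → Ordinal) (m : ℕ) :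
    takF prec β m = 0 ∨ ∃ i < m, prec i m ∧ takF prec β m = takF prec β i + ω ^ β m := by
  classical
  rcases Nat.eq_zero_or_pos m with rfl | hm
  · left
    rw [takF.eq_1]
    simp
  · have : Nonempty (Fin m) := ⟨⟨0, hm⟩⟩
    obtain ⟨i, -, hi⟩ := Finset.exists_mem_eq_sup (Finset.univ : Finset (Fin m))
      Finset.univ_nonempty
      (fun i => if prec i.1 m then takF prec β i.1 + ω ^ β m else 0)
    rw [← takF.eq_1 prec β m] at hi
    by_cases hp : prec i.1 m
    · right
      exact ⟨i.1, i.2, hp, by simpa [hp] using hi⟩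
    · left
      simpa [hp] using hi

theorem opow_add_absorb {a b : Ordinal} (h : a < b) : ω ^ a + ω ^ b = ω ^ b :=
  add_of_omega0_opow_le ((opow_lt_opow_iff_right one_lt_omega0).2 h) le_rfl

/-- Takeuti's embedding theorem (combinatorial core).
`prec` is a linear order on ℕ whose `prec`-least element is `0`, `α` an ordinal,
and `β : ℕ → Ordinal` a rank function with `β m < α`.  If for every `m`, whenever the set
`{k | k < m (usual order) ∧ prec m k}` is nonempty and `s` is its `prec`-least element we have
`β m < β s`, then there is `f : ℕ → Ordinal` with `f m < ω ^ α` for all `m` and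
`prec n m → f n < f m`. -/
theorem stmt0 (prec : ℕ → ℕ → Prop)
    [IsIrrefl ℕ prec] [IsTrans ℕ prec] [IsTrichotomous ℕ prec]
    (hleast : ∀ n : ℕ, n ≠ 0 → prec 0 n)
    (α : Ordinal) (β : ℕ → Ordinal) (hβ : ∀ m : ℕ, β m < α)
    (hrank : ∀ m s : ℕ, s < m → prec m s →
      (∀ k : ℕ, k < m → prec m k → k = s ∨ prec s k) → β m < β s) :
    ∃ f : ℕ → Ordinal, (∀ m : ℕ, f m < ω ^ α) ∧ ∀ n m : ℕ, prec n m → f n < f m := by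
  classical
  have irr : ∀ a, ¬ prec a a := fun a => irrefl_of prec a
  have tr : ∀ a b c, prec a b → prec b c → prec a c := fun a b c => trans_of prec
  have tri : ∀ a b, prec a b ∨ a = b ∨ prec b a := fun a b => trichotomous_of prec a b
  have key : ∀ n, ∀ i < n, ∀ j < n, prec i j →
      takF prec β i + ω ^ β j ≤ takF prec β j := by
    intro n
    induction n with
    | zero => intro i hi; omega
    | succ n ih =>
      intro i hi j hj hij
      rcases Nat.lt_succ_iff_lt_or_eq.1 hj with hj | rfl
      · rcases Nat.lt_succ_iff_lt_or_eq.1 hi with hi | rfl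
        · exact ih i hi j hj hij
        · -- new element below an old one
          have hex : ∃ s < i, prec i s ∧ ∀ k, k < i → prec i k → k = s ∨ prec s k := by
            have aux : ∀ N ≤ i, (∃ k < N, prec i k) →
                ∃ s < N, prec i s ∧ ∀ k, k < N → prec i k → k = s ∨ prec s k := by
              intro N
              induction N with
              | zero => rintro - ⟨k, hk, -⟩; omega
              | succ N ihN =>
                rintro hN ⟨k, hk, hik⟩
                by_cases hE : ∃ k < N, prec i k
                · obtain ⟨s, hs, his, hmin⟩ := ihN (by omega) hE
                  by_cases hc : prec i N ∧ prec N s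
                  · refine ⟨N, by omega, hc.1, fun k hk hik => ?_⟩
                    rcases Nat.lt_succ_iff_lt_or_eq.1 hk with hk | rfl
                    · rcases hmin k hk hik with rfl | h
                      · exact Or.inr hc.2
                      · exact Or.inr (tr _ _ _ hc.2 h)
                    · exact Or.inl rfl
                  · refine ⟨s, by omega, his, fun k hk hik => ?_⟩
                    rcases Nat.lt_succ_iff_lt_or_eq.1 hk with hk | rfl
                    · exact hmin k hk hik
                    · rcases tri k s with h | h | h
                      · exact absurd ⟨hik, h⟩ hc
                      · exact Or.inl h
                      · exact Or.inr h
                · refine ⟨k, hk, hik, fun l hl hil => ?_⟩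
                  have h1 : k = N := by
                    by_contra hne
                    exact hE ⟨k, by omega, hik⟩
                  have h2 : l = N := by
                    by_contra hne
                    exact hE ⟨l, by omega, hil⟩
                  exact Or.inl (h2.trans h1.symm)
            exact aux i le_rfl ⟨j, hj, hij⟩
          obtain ⟨s, hs, his, hmin⟩ := hex
          have hb := hrank i s hs his hmin
          have hS : takF prec β i + ω ^ β s ≤ takF prec β s := by
            rcases takF_le prec β i with h0 | ⟨p, hp, hpi, he⟩
            · have h00 := hleast i (by omega)
              have h1 := takF_ge prec β 0 i (by omega) h00
              have h2 := ih 0 (by omega) s hs (tr _ _ _ h00 his)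
              rw [h0]
              exact le_trans (add_le_add_left (zero_le) _) h2
            · rw [he, add_assoc, opow_add_absorb hb]
              exact ih p hp s hs (tr _ _ _ hpi his)
          rcases hmin j hj hij with rfl | h
          · exact hS
          · refine le_trans ?_ (ih s hs j hj h)
            gcongr
            exact le_trans le_self_add hS
      · rcases Nat.lt_succ_iff_lt_or_eq.1 hi with hi | rfl
        · exact takF_ge prec β i j hi hij
        · exact absurd hij (irr _)
  refine ⟨takF prec β, ?_, ?_⟩
  · intro m
    induction m using Nat.strong_induction_on with
    | _ m ih =>
      rcases takF_le prec β m with h0 | ⟨p, hp, -, he⟩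
      · rw [h0]
        exact opow_pos _ omega0_pos
      · rw [he]
        exact (isPrincipal_add_omega0_opow α) (ih p hp)
          ((opow_lt_opow_iff_right one_lt_omega0).2 (hβ m))
  · intro n m h
    refine lt_of_lt_of_le ?_ (key (n + m + 1) n (by omega) m (by omega) h)
    exact lt_add_of_pos_right _ (opow_pos _ omega0_pos)
end

section
/- Let X and Y be linear orders and let e : X ↪o Y be an order embedding. Equip X →₀ ℕ (finitely supported functions from X to ℕ) with the anti-lexicographic strict order: u < v if and only if u ≠ v and u i < v i, where i is the maximal element of X at which u and v differ; equip Y →₀ ℕ with the analogous order. Then the map Finsupp.embDomain along e is an order embedding from X →₀ ℕ into Y →₀ ℕ: for all u, v : X →₀ ℕ, u < v implies embDomain e u < embDomain e v. -/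
/-- The anti-lexicographic strict order on finitely supported functions `X →₀ ℕ`:
`u < v` iff `u ≠ v` and `u i < v i` for `i` the maximal element of `X` at which `u` and `v`
differ; equivalently, there is an `i` with `u i < v i` such that `u` and `v` agree above `i`. -/
def AntiLexLt {X : Type*} [LinearOrder X] (u v : X →₀ ℕ) : Prop :=
  ∃ i : X, u i < v i ∧ ∀ j : X, i < j → u j = v j

/-- For an order embedding `e : X ↪o Y` between linear orders,
`Finsupp.embDomain` along `e` is order preserving for the anti-lexicographic orders
on `X →₀ ℕ` and `Y →₀ ℕ`. -/
theorem stmt11 {X Y : Type*} [LinearOrder X] [LinearOrder Y] (e : X ↪o Y)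
    (u v : X →₀ ℕ) (h : AntiLexLt u v) :
    AntiLexLt (Finsupp.embDomain e.toEmbedding u) (Finsupp.embDomain e.toEmbedding v) := by
  obtain ⟨i, hi, hj⟩ := h
  refine ⟨e.toEmbedding i, ?_, ?_⟩
  · rw [Finsupp.embDomain_apply_self, Finsupp.embDomain_apply_self]
    exact hi
  · intro y hy
    by_cases hr : y ∈ Set.range e.toEmbedding
    · obtain ⟨j, rfl⟩ := hr
      rw [Finsupp.embDomain_apply_self, Finsupp.embDomain_apply_self]
      exact hj j (e.lt_iff_lt.mp hy)
    · rw [Finsupp.embDomain_notin_range _ _ _ hr, Finsupp.embDomain_notin_range _ _ _ hr]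
end
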